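/- Let A : ℝ^{N×N}, L : ℝ^{N×N}, b ∈ ℝ^N, μ > 0, ρ > 0. Suppose the unaugmented Lagrangian L₀ admits a saddle point (x*, z*, y*, w*; λ*), i.e. L₀(x*,z*,y*,w*;λ) ≤ L₀(x*,z*,y*,w*;λ*) ≤ L₀(x,z,y,w;λ*) for all x,z,y,w ∈ ℝ^N and λ ∈ ℝ^{3N}. Let sequences (x^k), (z^k), (y^k), (w^k) in ℝ^N and (λ^k) in ℝ^{3N} satisfy the ADMM iteration: (x^{k+1}, z^{k+1}) minimizes (x,z) ↦ L_ρ(x,z,y^k,w^k;λ^k); (y^{k+1}, w^{k+1}) minimizes (y,w) ↦ L_ρ(x^{k+1},z^{k+1},y,w;λ^k); and λ^{k+1} = λ^k + ρ·r(x^{k+1},z^{k+1},y^{k+1},w^{k+1}). Then the residuals converge to feasibility, ‖r(x^k,z^k,y^k,w^k)‖ → 0 as k → ∞, and the objective values converge to the optimal value: (1/2)‖A x^k − b‖² + μ‖z^k‖₁ + ι₀(w^k) → p*, where p* is the infimum of (1/2)‖Ax − b‖² + μ‖Lx‖₁ over {x ∈ ℝ^N : x ≥ 0}. -/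

import Mathlib

open Filter Topology

/-- Squared Euclidean norm of a vector in `ℝ^N`. -/
noncomputable def sqnorm {N : ℕ} (v : Fin N → ℝ) : ℝ := ∑ i, (v i) ^ 2

/-- The `ℓ¹` norm of a vector in `ℝ^N`. -/
noncomputable def l1norm {N : ℕ} (v : Fin N → ℝ) : ℝ := ∑ i, |v i|

/-- Euclidean inner product on `ℝ^N`. -/
noncomputable def ip {N : ℕ} (u v : Fin N → ℝ) : ℝ := ∑ i, u i * v i

/-- Euclidean inner product on `ℝ^{3N}` viewed as a triple of vectors. -/
noncomputable def ip3 {N : ℕ} (u v : (Fin N → ℝ) × (Fin N → ℝ) × (Fin N → ℝ)) : ℝ :=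
  ip u.1 v.1 + ip u.2.1 v.2.1 + ip u.2.2 v.2.2

/-- Squared Euclidean norm on `ℝ^{3N}` viewed as a triple of vectors. -/
noncomputable def sqnorm3 {N : ℕ} (u : (Fin N → ℝ) × (Fin N → ℝ) × (Fin N → ℝ)) : ℝ :=
  sqnorm u.1 + sqnorm u.2.1 + sqnorm u.2.2

open Classical in
/-- Indicator function `ι₀` of the nonnegative orthant, with values in the extended reals. -/
noncomputable def iota0 {N : ℕ} (w : Fin N → ℝ) : EReal := if 0 ≤ w then 0 else ⊤

/-- Constraint residual `r(x,z,y,w) = (x − y, z − Ly, x − w) ∈ ℝ^{3N}`. -/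
noncomputable def resid {N : ℕ} (L : Matrix (Fin N) (Fin N) ℝ) (x z y w : Fin N → ℝ) :
    (Fin N → ℝ) × (Fin N → ℝ) × (Fin N → ℝ) :=
  (x - y, z - L.mulVec y, x - w)

/-- The unaugmented Lagrangian
`L₀(x,z,y,w;λ) = (1/2)‖Ax − b‖² + μ‖z‖₁ + ι₀(w) + ⟨λ, r(x,z,y,w)⟩`. -/
noncomputable def lag0 {N : ℕ} (A L : Matrix (Fin N) (Fin N) ℝ) (b : Fin N → ℝ) (μ : ℝ)
    (x z y w : Fin N → ℝ) (lam : (Fin N → ℝ) × (Fin N → ℝ) × (Fin N → ℝ)) : EReal :=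
  ((1 / 2 * sqnorm (A.mulVec x - b) + μ * l1norm z + ip3 lam (resid L x z y w) : ℝ) : EReal)
    + iota0 w

/-- The augmented Lagrangian `L_ρ = L₀ + (ρ/2)‖r(x,z,y,w)‖²`. -/
noncomputable def lagAug {N : ℕ} (A L : Matrix (Fin N) (Fin N) ℝ) (b : Fin N → ℝ) (μ ρ : ℝ)
    (x z y w : Fin N → ℝ) (lam : (Fin N → ℝ) × (Fin N → ℝ) × (Fin N → ℝ)) : EReal :=
  lag0 A L b μ x z y w lam + ((ρ / 2 * sqnorm3 (resid L x z y w) : ℝ) : EReal)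

section Abstract

variable {E E₁ E₂ H : Type*} [AddCommGroup E] [Module ℝ E] [AddCommGroup E₁] [Module ℝ E₁]
  [AddCommGroup E₂] [Module ℝ E₂] [NormedAddCommGroup H] [InnerProductSpace ℝ H]

lemma nonneg_of_forall_mul_add_sq_nonneg {a c : ℝ}
    (h : ∀ t : ℝ, 0 < t → t ≤ 1 → 0 ≤ t * a + t ^ 2 * c) : 0 ≤ a := by
  have key : ∀ᶠ t : ℝ in 𝓝[>] 0, 0 ≤ a + t * c := by
    filter_upwards [Ioc_mem_nhdsGT (zero_lt_one' ℝ)] with t ht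
    have h1 := h t ht.1 ht.2
    have h2 : t * a + t ^ 2 * c = t * (a + t * c) := by ring
    exact nonneg_of_mul_nonneg_right (h2 ▸ h1) ht.1
  have lim : Tendsto (fun t : ℝ => a + t * c) (𝓝[>] 0) (𝓝 a) := by
    have : Tendsto (fun t : ℝ => a + t * c) (𝓝 0) (𝓝 (a + 0 * c)) :=
      (by fun_prop : Continuous fun t : ℝ => a + t * c).tendsto 0
    simpa using this.mono_left nhdsWithin_le_nhds
  exact ge_of_tendsto lim key

/-- First-order optimality condition for a convex function plus a linear and a quadratic term. -/
lemma ConvexOn.le_add_inner_of_isMinOn {C : Set E} {f : E → ℝ} (hf : ConvexOn ℝ C f)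
    (R : E →ₗ[ℝ] H) (c l : H) (ρ : ℝ) {u : E} (hu : u ∈ C)
    (hmin : ∀ u' ∈ C, f u + inner ℝ l (R u + c) + ρ / 2 * ‖R u + c‖ ^ 2 ≤
      f u' + inner ℝ l (R u' + c) + ρ / 2 * ‖R u' + c‖ ^ 2) {u' : E} (hu' : u' ∈ C) :
    f u ≤ f u' + inner ℝ (l + ρ • (R u + c)) (R u' - R u) := by
  suffices h : 0 ≤ f u' - f u + inner ℝ (l + ρ • (R u + c)) (R u' - R u) by linarith
  refine nonneg_of_forall_mul_add_sq_nonneg (c := ρ / 2 * ‖R u' - R u‖ ^ 2) fun t ht0 ht1 => ?_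
  have h1 := hmin _ (hf.1 hu hu' (sub_nonneg.2 ht1) ht0.le (by ring))
  have h2 := hf.2 hu hu' (sub_nonneg.2 ht1) ht0.le (by ring)
  have h3 : R ((1 - t) • u + t • u') + c = (R u + c) + t • (R u' - R u) := by
    simp only [map_add, map_smul]; module
  rw [h3, norm_add_sq_real (R u + c) (t • _), inner_add_right l (R u + c) (t • _),
    inner_smul_right, inner_smul_right, norm_smul, mul_pow, Real.norm_eq_abs, sq_abs] at h1
  rw [inner_add_left, real_inner_smul_left]
  simp only [smul_eq_mul] at h2
  linarith

/-- Convergence of residuals and objective values from the three basic ADMM inequalities. -/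
lemma tendsto_of_admm_inequalities {ρ p : ℝ} (hρ : 0 < ρ) {m q l : ℕ → H} {ls : H} {P : ℕ → ℝ}
    (hl : ∀ k, l (k + 1) = l k + ρ • (m (k + 1) - q (k + 1)))
    (hlow : ∀ k, p ≤ P (k + 1) + inner ℝ ls (m (k + 1) - q (k + 1)))
    (hup : ∀ k, P (k + 1) ≤ p - inner ℝ (l (k + 1) + ρ • (q (k + 1) - q k)) (m (k + 1))
      + inner ℝ (l (k + 1)) (q (k + 1)))
    (hmono : ∀ k, 0 ≤ inner ℝ (l (k + 1) - l k) (q (k + 1) - q k)) :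
    Tendsto (fun k => ‖m (k + 1) - q (k + 1)‖) atTop (𝓝 0) ∧
      Tendsto (fun k => P (k + 1)) atTop (𝓝 p) := by
  set r : ℕ → H := fun k => m (k + 1) - q (k + 1) with hr
  set d : ℕ → H := fun k => q (k + 1) - q k with hd
  set V : ℕ → ℝ := fun k => ‖l k - ls‖ ^ 2 + ρ ^ 2 * ‖q k‖ ^ 2 with hV
  have hm : ∀ k, m (k + 1) = r k + q (k + 1) := fun k => by simp [hr]
  have hq : ∀ k, q k = q (k + 1) - d k := fun k => by simp [hd]
  have hlk : ∀ k, l k = l (k + 1) - ρ • r k := fun k => by rw [hl k]; simp [hr]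
  have step : ∀ k, ρ ^ 2 * (‖r k‖ ^ 2 + ‖d k‖ ^ 2) ≤ V k - V (k + 1) := by
    intro k
    have h1 := hlow k
    have h2 := hup k
    have h3 := hmono k
    have h4 : l (k + 1) - l k = ρ • r k := by rw [hlk k]; abel
    have h5 : l k - ls = (l (k + 1) - ls) - ρ • r k := by rw [hlk k]; abel
    have h3' : 0 ≤ inner ℝ (r k) (d k) := by
      rw [h4, real_inner_smul_left] at h3
      exact nonneg_of_mul_nonneg_right h3 hρ
    change p ≤ P (k + 1) + inner ℝ ls (r k) at h1
    change P (k + 1) ≤ p - inner ℝ (l (k + 1) + ρ • d k) (m (k + 1))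
      + inner ℝ (l (k + 1)) (q (k + 1)) at h2
    simp only [hV]
    have e1 : ‖q k‖ ^ 2 = ‖q (k + 1)‖ ^ 2 - 2 * inner ℝ (q (k + 1)) (d k) + ‖d k‖ ^ 2 := by
      rw [hq k]; exact norm_sub_sq_real _ _
    have e2 : ‖l k - ls‖ ^ 2 = ‖l (k + 1) - ls‖ ^ 2
        - 2 * (ρ * (inner ℝ (l (k + 1)) (r k) - inner ℝ ls (r k))) + ρ ^ 2 * ‖r k‖ ^ 2 := by
      rw [h5, norm_sub_sq_real (l (k + 1) - ls) (ρ • r k), norm_smul, inner_smul_right,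
        inner_sub_left, mul_pow, Real.norm_eq_abs, sq_abs]
    rw [e1, e2]
    rw [hm k] at h2
    simp only [inner_add_left, inner_add_right, real_inner_smul_left] at h2
    rw [real_inner_comm (q (k + 1)) (d k), real_inner_comm (r k) (d k)] at h2
    have h6 : 0 ≤ ρ * (inner ℝ ls (r k) - inner ℝ (l (k + 1)) (r k)
        - ρ * inner ℝ (r k) (d k) - ρ * inner ℝ (q (k + 1)) (d k)) :=
      mul_nonneg hρ.le (by linarith)
    have h7 := mul_nonneg (sq_nonneg ρ) h3'
    linarith
  have hV0 : ∀ k, 0 ≤ V k := fun k => by positivity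
  have hanti : Antitone V := antitone_nat_of_succ_le fun k => by
    have : 0 ≤ ρ ^ 2 * (‖r k‖ ^ 2 + ‖d k‖ ^ 2) := by positivity
    linarith [step k]
  have hVlim : Tendsto (fun k => (V k - V (k + 1)) / ρ ^ 2) atTop (𝓝 0) := by
    have h := tendsto_atTop_ciInf hanti ⟨0, by rintro _ ⟨k, rfl⟩; exact hV0 k⟩
    simpa using (h.sub (h.comp (tendsto_add_atTop_nat 1))).div_const (ρ ^ 2)
  have hbound : ∀ k, ‖r k‖ ^ 2 + ‖d k‖ ^ 2 ≤ (V k - V (k + 1)) / ρ ^ 2 := fun k => by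
    rw [le_div_iff₀ (by positivity), mul_comm]; exact step k
  have hlim : ∀ s : ℕ → H, (∀ k, ‖s k‖ ^ 2 ≤ ‖r k‖ ^ 2 + ‖d k‖ ^ 2) →
      Tendsto (fun k => ‖s k‖) atTop (𝓝 0) := fun s hs => by
    have := squeeze_zero (fun k => sq_nonneg ‖s k‖) (fun k => (hs k).trans (hbound k)) hVlim
    simpa using this.sqrt
  have hr0 : Tendsto (fun k => ‖r k‖) atTop (𝓝 0) :=
    hlim r fun k => le_add_of_nonneg_right (sq_nonneg _)
  have hd0 : Tendsto (fun k => ‖d k‖) atTop (𝓝 0) :=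
    hlim d fun k => le_add_of_nonneg_left (sq_nonneg _)
  have hlb : ∀ k, ‖l k‖ ≤ √(V 0) + ‖ls‖ := fun k => by
    have h : ‖l k - ls‖ ≤ √(V 0) := Real.le_sqrt_of_sq_le
      ((le_add_of_nonneg_right (by positivity)).trans (hanti (Nat.zero_le k)))
    linarith [norm_sub_norm_le (l k) ls]
  have hqb : ∀ k, ‖q k‖ ≤ √(V 0) / ρ := fun k => by
    rw [le_div_iff₀ hρ]
    refine Real.le_sqrt_of_sq_le (le_trans ?_ (hanti (Nat.zero_le k)))
    simp only [hV, mul_pow]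
    nlinarith [sq_nonneg ‖l k - ls‖]
  refine ⟨hr0, tendsto_of_tendsto_of_tendsto_of_le_of_le
    (g := fun k => p - ‖ls‖ * ‖r k‖)
    (h := fun k => p + ((√(V 0) + ‖ls‖) * ‖r k‖ + ρ * (‖d k‖ * (‖r k‖ + √(V 0) / ρ))))
    ?_ ?_ (fun k => ?_) (fun k => ?_)⟩
  · simpa using (hr0.const_mul ‖ls‖).const_sub p
  · simpa using ((hr0.const_mul (√(V 0) + ‖ls‖)).add
      ((hd0.mul (hr0.add_const (√(V 0) / ρ))).const_mul ρ)).const_add p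
  · have h1 := hlow k
    have h2 := real_inner_le_norm ls (r k)
    change p ≤ P (k + 1) + inner ℝ ls (r k) at h1
    change p - ‖ls‖ * ‖r k‖ ≤ P (k + 1)
    linarith
  · have h2 := hup k
    change P (k + 1) ≤ p - inner ℝ (l (k + 1) + ρ • d k) (m (k + 1))
      + inner ℝ (l (k + 1)) (q (k + 1)) at h2
    change P (k + 1) ≤ p + ((√(V 0) + ‖ls‖) * ‖r k‖ + ρ * (‖d k‖ * (‖r k‖ + √(V 0) / ρ)))
    have h3 : -inner ℝ (l (k + 1)) (r k) ≤ (√(V 0) + ‖ls‖) * ‖r k‖ :=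
      (neg_le_abs _).trans ((abs_real_inner_le_norm _ _).trans
        (mul_le_mul_of_nonneg_right (hlb _) (norm_nonneg _)))
    have h4 : -inner ℝ (d k) (m (k + 1)) ≤ ‖d k‖ * (‖r k‖ + √(V 0) / ρ) := by
      refine (neg_le_abs _).trans ((abs_real_inner_le_norm _ _).trans
        (mul_le_mul_of_nonneg_left ?_ (norm_nonneg _)))
      rw [hm k]
      exact (norm_add_le _ _).trans (add_le_add_right (hqb _) _)
    have h5 := mul_le_mul_of_nonneg_left h4 hρ.le
    have h6 : inner ℝ (l (k + 1)) (m (k + 1)) =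
        inner ℝ (l (k + 1)) (r k) + inner ℝ (l (k + 1)) (q (k + 1)) := by
      rw [hm k, inner_add_right]
    rw [inner_add_left, real_inner_smul_left] at h2
    linarith

/-- Convergence of ADMM for minimizing `f u` subject to `M u = K v`, `v ∈ C`, given a saddle point
of the Lagrangian. -/
theorem admm_tendsto {C : Set E₂} (hC : Convex ℝ C) {f : E₁ → ℝ} (hf : ConvexOn ℝ Set.univ f)
    (M : E₁ →ₗ[ℝ] H) (K : E₂ →ₗ[ℝ] H) {ρ : ℝ} (hρ : 0 < ρ)
    {us : E₁} {vs : E₂} {ls : H} (hvs : vs ∈ C) (hfeas : M us = K vs)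
    (hsaddle : ∀ u, ∀ v ∈ C, f us ≤ f u + inner ℝ ls (M u - K v))
    {u : ℕ → E₁} {v : ℕ → E₂} {l : ℕ → H} (hvC : ∀ k, v k ∈ C)
    (hu : ∀ k u', f (u (k + 1)) + inner ℝ (l k) (M (u (k + 1)) - K (v k))
        + ρ / 2 * ‖M (u (k + 1)) - K (v k)‖ ^ 2 ≤
      f u' + inner ℝ (l k) (M u' - K (v k)) + ρ / 2 * ‖M u' - K (v k)‖ ^ 2)
    (hv : ∀ k, ∀ v' ∈ C, inner ℝ (l k) (M (u (k + 1)) - K (v (k + 1)))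
        + ρ / 2 * ‖M (u (k + 1)) - K (v (k + 1))‖ ^ 2 ≤
      inner ℝ (l k) (M (u (k + 1)) - K v') + ρ / 2 * ‖M (u (k + 1)) - K v'‖ ^ 2)
    (hl : ∀ k, l (k + 1) = l k + ρ • (M (u (k + 1)) - K (v (k + 1)))) :
    Tendsto (fun k => ‖M (u k) - K (v k)‖) atTop (𝓝 0) ∧
      Tendsto (fun k => f (u k)) atTop (𝓝 (f us)) := by
  have optv : ∀ k, ∀ v' ∈ C, 0 ≤ inner ℝ (l (k + 1)) (K (v (k + 1)) - K v') := by
    intro k v' hv'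
    have h := (convexOn_const (0 : ℝ) hC).le_add_inner_of_isMinOn (-K) (M (u (k + 1))) (l k) ρ
      (hvC (k + 1)) (fun v' hv' => by
        simpa [neg_add_eq_sub] using hv k v' hv') hv'
    simp only [LinearMap.neg_apply, neg_add_eq_sub, ← hl k, zero_add] at h
    rwa [sub_neg_eq_add, neg_add_eq_sub] at h
  have optu : ∀ k, f (u (k + 1)) ≤ f us
      + inner ℝ (l (k + 1) + ρ • (K (v (k + 1)) - K (v k))) (M us - M (u (k + 1))) := by
    intro k
    have h := hf.le_add_inner_of_isMinOn M (-K (v k)) (l k) ρ (Set.mem_univ (u (k + 1)))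
      (fun u' _ => by simpa [← sub_eq_add_neg] using hu k u') (Set.mem_univ us)
    have e : l k + ρ • (M (u (k + 1)) + -K (v k)) =
        l (k + 1) + ρ • (K (v (k + 1)) - K (v k)) := by rw [hl k]; module
    rwa [e] at h
  have main := tendsto_of_admm_inequalities (p := f us) hρ
    (m := fun k => M (u (k + 1)) - K vs) (q := fun k => K (v (k + 1)) - K vs)
    (l := fun k => l (k + 1)) (ls := ls) (P := fun k => f (u (k + 1)))
    (fun k => by simp only [sub_sub_sub_cancel_right]; exact hl (k + 1))
    (fun k => by
      simp only [sub_sub_sub_cancel_right]; exact hsaddle _ _ (hvC _))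
    (fun k => by
      have h1 := optu (k + 1)
      have h2 := optv (k + 1) vs hvs
      rw [hfeas, ← neg_sub (M _), inner_neg_right] at h1
      simp only [sub_sub_sub_cancel_right]
      linarith)
    (fun k => by
      have h1 := optv k _ (hvC (k + 2))
      have h2 := optv (k + 1) _ (hvC (k + 1))
      rw [← neg_sub, inner_neg_right] at h1
      simp only [sub_sub_sub_cancel_right, inner_sub_left]
      linarith)
  simp only [sub_sub_sub_cancel_right] at main
  exact ⟨(tendsto_add_atTop_iff_nat 2).1 main.1, (tendsto_add_atTop_iff_nat 2).1 main.2⟩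

end Abstract

section Concrete

variable {N : ℕ}

/-- The linear map sending a triple of vectors to Euclidean space of dimension `3N`. -/
noncomputable def tripleToEuclidean (N : ℕ) : ((Fin N → ℝ) × (Fin N → ℝ) × (Fin N → ℝ)) →ₗ[ℝ]
    EuclideanSpace ℝ (Fin N ⊕ Fin N ⊕ Fin N) where
  toFun u := WithLp.toLp 2 (Sum.elim u.1 (Sum.elim u.2.1 u.2.2))
  map_add' u v := by ext (i | i | i) <;> simp
  map_smul' c u := by ext (i | i | i) <;> simp

lemma inner_tripleToEuclidean (u v : (Fin N → ℝ) × (Fin N → ℝ) × (Fin N → ℝ)) :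
    inner ℝ (tripleToEuclidean N u) (tripleToEuclidean N v) = ip3 u v := by
  simp [tripleToEuclidean, ip3, ip, PiLp.inner_apply, Fintype.sum_sum_type, mul_comm, add_assoc]

lemma norm_tripleToEuclidean_sq (u : (Fin N → ℝ) × (Fin N → ℝ) × (Fin N → ℝ)) :
    ‖tripleToEuclidean N u‖ ^ 2 = sqnorm3 u := by
  simp [tripleToEuclidean, sqnorm3, sqnorm, EuclideanSpace.norm_sq_eq,
    Fintype.sum_sum_type, add_assoc]

lemma iota0_of_nonneg {w : Fin N → ℝ} (hw : 0 ≤ w) : iota0 w = 0 := if_pos hw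

lemma iota0_of_not_nonneg {w : Fin N → ℝ} (hw : ¬ 0 ≤ w) : iota0 w = ⊤ := if_neg hw

/-- The part of the objective without the indicator function. -/
noncomputable def finiteObj (A : Matrix (Fin N) (Fin N) ℝ) (b : Fin N → ℝ) (μ : ℝ)
    (u : (Fin N → ℝ) × (Fin N → ℝ)) : ℝ :=
  1 / 2 * sqnorm (A.mulVec u.1 - b) + μ * l1norm u.2

lemma convexOn_sqnorm : ConvexOn ℝ Set.univ (sqnorm (N := N)) := by
  refine ⟨convex_univ, fun x _ y _ s t hs ht hst => ?_⟩
  simp only [sqnorm, smul_eq_mul, Finset.mul_sum, ← Finset.sum_add_distrib]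
  exact Finset.sum_le_sum fun i _ =>
    (even_two.convexOn_pow (𝕜 := ℝ)).2 (Set.mem_univ (x i)) (Set.mem_univ (y i)) hs ht hst

lemma convexOn_l1norm : ConvexOn ℝ Set.univ (l1norm (N := N)) := by
  refine ⟨convex_univ, fun x _ y _ s t hs ht hst => ?_⟩
  simp only [l1norm, smul_eq_mul, Finset.mul_sum, ← Finset.sum_add_distrib]
  refine Finset.sum_le_sum fun i _ => (abs_add_le _ _).trans_eq ?_
  simp [abs_mul, abs_of_nonneg hs, abs_of_nonneg ht]

lemma convexOn_finiteObj (A : Matrix (Fin N) (Fin N) ℝ) (b : Fin N → ℝ) {μ : ℝ} (hμ : 0 ≤ μ) :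
    ConvexOn ℝ Set.univ (finiteObj A b μ) := by
  refine ConvexOn.add (ConvexOn.smul (by norm_num : (0 : ℝ) ≤ 1 / 2) ?_)
    (ConvexOn.smul hμ (convexOn_l1norm.comp_linearMap (LinearMap.snd ℝ _ _)))
  exact convexOn_sqnorm.comp_affineMap
    ((A.mulVecLin.comp (LinearMap.fst ℝ _ (Fin N → ℝ))).toAffineMap - AffineMap.const ℝ _ b)

lemma lag0_of_nonneg {A L : Matrix (Fin N) (Fin N) ℝ} {b : Fin N → ℝ} {μ : ℝ}
    {x z y w : Fin N → ℝ} {lam : (Fin N → ℝ) × (Fin N → ℝ) × (Fin N → ℝ)} (hw : 0 ≤ w) :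
    lag0 A L b μ x z y w lam =
      ((finiteObj A b μ (x, z) + ip3 lam (resid L x z y w) : ℝ) : EReal) := by
  rw [lag0, iota0_of_nonneg hw, add_zero, finiteObj]

lemma lag0_of_not_nonneg {A L : Matrix (Fin N) (Fin N) ℝ} {b : Fin N → ℝ} {μ : ℝ}
    {x z y w : Fin N → ℝ} {lam : (Fin N → ℝ) × (Fin N → ℝ) × (Fin N → ℝ)} (hw : ¬ 0 ≤ w) :
    lag0 A L b μ x z y w lam = ⊤ := by
  rw [lag0, iota0_of_not_nonneg hw, EReal.coe_add_top]

lemma lagAug_of_nonneg {A L : Matrix (Fin N) (Fin N) ℝ} {b : Fin N → ℝ} {μ ρ : ℝ}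
    {x z y w : Fin N → ℝ} {lam : (Fin N → ℝ) × (Fin N → ℝ) × (Fin N → ℝ)} (hw : 0 ≤ w) :
    lagAug A L b μ ρ x z y w lam = ((finiteObj A b μ (x, z) + ip3 lam (resid L x z y w)
      + ρ / 2 * sqnorm3 (resid L x z y w) : ℝ) : EReal) := by
  rw [lagAug, lag0_of_nonneg hw, ← EReal.coe_add]

lemma lagAug_of_not_nonneg {A L : Matrix (Fin N) (Fin N) ℝ} {b : Fin N → ℝ} {μ ρ : ℝ}
    {x z y w : Fin N → ℝ} {lam : (Fin N → ℝ) × (Fin N → ℝ) × (Fin N → ℝ)} (hw : ¬ 0 ≤ w) :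
    lagAug A L b μ ρ x z y w lam = ⊤ := by
  rw [lagAug, lag0_of_not_nonneg hw, EReal.top_add_coe]

/-- The part of the constraint depending on `(x, z)`. -/
noncomputable def primalMap (N : ℕ) : ((Fin N → ℝ) × (Fin N → ℝ)) →ₗ[ℝ]
    EuclideanSpace ℝ (Fin N ⊕ Fin N ⊕ Fin N) :=
  tripleToEuclidean N ∘ₗ (LinearMap.fst ℝ _ _).prod
    ((LinearMap.snd ℝ _ _).prod (LinearMap.fst ℝ _ _))

/-- The part of the constraint depending on `(y, w)`. -/
noncomputable def splitMap (L : Matrix (Fin N) (Fin N) ℝ) : ((Fin N → ℝ) × (Fin N → ℝ)) →ₗ[ℝ]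
    EuclideanSpace ℝ (Fin N ⊕ Fin N ⊕ Fin N) :=
  tripleToEuclidean N ∘ₗ (LinearMap.fst ℝ _ _).prod
    ((L.mulVecLin ∘ₗ LinearMap.fst ℝ _ _).prod (LinearMap.snd ℝ _ _))

lemma tripleToEuclidean_resid (L : Matrix (Fin N) (Fin N) ℝ) (x z y w : Fin N → ℝ) :
    tripleToEuclidean N (resid L x z y w) = primalMap N (x, z) - splitMap L (y, w) := by
  simp only [primalMap, splitMap, LinearMap.comp_apply, ← map_sub]
  rfl

/-- A saddle point of the Lagrangian is primal feasible. -/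
lemma feasible_of_saddle {A L : Matrix (Fin N) (Fin N) ℝ} {b : Fin N → ℝ} {μ : ℝ}
    {xs zs ys ws : Fin N → ℝ} {ls : (Fin N → ℝ) × (Fin N → ℝ) × (Fin N → ℝ)}
    (h1 : ∀ lam, lag0 A L b μ xs zs ys ws lam ≤ lag0 A L b μ xs zs ys ws ls)
    (h2 : ∀ x z y w, lag0 A L b μ xs zs ys ws ls ≤ lag0 A L b μ x z y w ls) :
    0 ≤ ws ∧ resid L xs zs ys ws = 0 := by
  have hws : 0 ≤ ws := by
    by_contra hn
    have h := h2 0 0 0 0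
    rw [lag0_of_not_nonneg hn, lag0_of_nonneg le_rfl, top_le_iff] at h
    exact EReal.coe_ne_top _ h
  refine ⟨hws, ?_⟩
  have h := h1 (ls + resid L xs zs ys ws)
  rw [lag0_of_nonneg hws, lag0_of_nonneg hws, EReal.coe_le_coe_iff, ← inner_tripleToEuclidean,
    ← inner_tripleToEuclidean, map_add, inner_add_left, real_inner_self_eq_norm_sq,
    norm_tripleToEuclidean_sq] at h
  have hz : ∀ v : Fin N → ℝ, sqnorm v = 0 → v = 0 := fun v hv => by
    funext i
    exact pow_eq_zero_iff two_ne_zero |>.1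
      ((Finset.sum_eq_zero_iff_of_nonneg fun i _ => sq_nonneg (v i)).1 hv i (Finset.mem_univ i))
  have hn : ∀ v : Fin N → ℝ, 0 ≤ sqnorm v := fun v => Finset.sum_nonneg fun i _ => sq_nonneg _
  have ha := hn (resid L xs zs ys ws).1
  have hb := hn (resid L xs zs ys ws).2.1
  have hc := hn (resid L xs zs ys ws).2.2
  rw [sqnorm3] at h
  exact Prod.ext (hz _ (by linarith)) (Prod.ext (hz _ (by linarith)) (hz _ (by linarith)))

end Concrete

/-- ADMM: residual convergence to feasibility and convergence of the objective values to the
optimal value `p*` of `min_{x ≥ 0} (1/2)‖Ax − b‖² + μ‖Lx‖₁`, assuming `L₀` has a saddle point. -/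
theorem admm_residual_and_objective_convergence
    {N : ℕ} (A L : Matrix (Fin N) (Fin N) ℝ) (b : Fin N → ℝ) (μ ρ : ℝ)
    (hμ : 0 < μ) (hρ : 0 < ρ)
    (hsaddle : ∃ (xs zs ys ws : Fin N → ℝ)
        (ls : (Fin N → ℝ) × (Fin N → ℝ) × (Fin N → ℝ)),
      (∀ lam, lag0 A L b μ xs zs ys ws lam ≤ lag0 A L b μ xs zs ys ws ls) ∧
      (∀ x z y w, lag0 A L b μ xs zs ys ws ls ≤ lag0 A L b μ x z y w ls))
    (X Z Y W : ℕ → (Fin N → ℝ))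
    (Λ : ℕ → (Fin N → ℝ) × (Fin N → ℝ) × (Fin N → ℝ))
    (hxz : ∀ k, ∀ x z : Fin N → ℝ,
      lagAug A L b μ ρ (X (k + 1)) (Z (k + 1)) (Y k) (W k) (Λ k) ≤
        lagAug A L b μ ρ x z (Y k) (W k) (Λ k))
    (hyw : ∀ k, ∀ y w : Fin N → ℝ,
      lagAug A L b μ ρ (X (k + 1)) (Z (k + 1)) (Y (k + 1)) (W (k + 1)) (Λ k) ≤
        lagAug A L b μ ρ (X (k + 1)) (Z (k + 1)) y w (Λ k))
    (hΛ : ∀ k, Λ (k + 1) =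
      Λ k + ρ • resid L (X (k + 1)) (Z (k + 1)) (Y (k + 1)) (W (k + 1))) :
    Tendsto (fun k => Real.sqrt (sqnorm3 (resid L (X k) (Z k) (Y k) (W k)))) atTop (𝓝 0) ∧
    Tendsto (fun k =>
        ((1 / 2 * sqnorm (A.mulVec (X k) - b) + μ * l1norm (Z k) : ℝ) : EReal) + iota0 (W k))
      atTop
      (𝓝 (⨅ x : {x : Fin N → ℝ // 0 ≤ x},
        ((1 / 2 * sqnorm (A.mulVec x.1 - b) + μ * l1norm (L.mulVec x.1) : ℝ) : EReal))) := by
  obtain ⟨xs, zs, ys, ws, ls, hs1, hs2⟩ := hsaddle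
  obtain ⟨hws, hres⟩ := feasible_of_saddle hs1 hs2
  have hW : ∀ k, 0 ≤ W (k + 1) := fun k => by
    by_contra hn
    have h := hyw k 0 0
    rw [lagAug_of_not_nonneg hn, lagAug_of_nonneg le_rfl, top_le_iff] at h
    exact EReal.coe_ne_top _ h
  have hsad : ∀ x z y w, 0 ≤ w →
      finiteObj A b μ (xs, zs) ≤ finiteObj A b μ (x, z) + ip3 ls (resid L x z y w) := by
    intro x z y w hw
    have h := hs2 x z y w
    rw [lag0_of_nonneg hws, lag0_of_nonneg hw, EReal.coe_le_coe_iff, hres] at h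
    simpa [ip3, ip] using h
  have main := admm_tendsto (C := {v : (Fin N → ℝ) × (Fin N → ℝ) | 0 ≤ v.2})
    ((convex_Ici (𝕜 := ℝ) (0 : Fin N → ℝ)).linear_preimage (LinearMap.snd ℝ _ _))
    (convexOn_finiteObj A b hμ.le) (primalMap N) (splitMap L) hρ
    (us := (xs, zs)) (vs := (ys, ws)) (ls := tripleToEuclidean N ls) hws
    (by rw [← sub_eq_zero, ← tripleToEuclidean_resid, hres, map_zero])
    (fun u v hv => by
      rw [← tripleToEuclidean_resid L u.1 u.2 v.1 v.2, inner_tripleToEuclidean]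
      exact hsad u.1 u.2 v.1 v.2 hv)
    (u := fun k => (X (k + 1), Z (k + 1))) (v := fun k => (Y (k + 1), W (k + 1)))
    (l := fun k => tripleToEuclidean N (Λ (k + 1))) hW
    (fun k u' => by
      obtain ⟨x, z⟩ := u'
      have h := hxz (k + 1) x z
      rw [lagAug_of_nonneg (hW k), lagAug_of_nonneg (hW k), EReal.coe_le_coe_iff] at h
      simpa only [← tripleToEuclidean_resid, inner_tripleToEuclidean,
        norm_tripleToEuclidean_sq] using h)
    (fun k v' hv' => by
      obtain ⟨y, w⟩ := v'
      have h := hyw (k + 1) y w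
      rw [lagAug_of_nonneg (hW (k + 1)), lagAug_of_nonneg hv', EReal.coe_le_coe_iff] at h
      simp only [← tripleToEuclidean_resid, inner_tripleToEuclidean, norm_tripleToEuclidean_sq]
      linarith)
    (fun k => by
      rw [← tripleToEuclidean_resid, ← map_smul, ← map_add, ← hΛ (k + 1)])
  obtain ⟨hr, hobj⟩ := main
  have hval : (⨅ x : {x : Fin N → ℝ // 0 ≤ x},
      ((1 / 2 * sqnorm (A.mulVec x.1 - b) + μ * l1norm (L.mulVec x.1) : ℝ) : EReal)) =
        (finiteObj A b μ (xs, zs) : EReal) := by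
    have hxy : xs = ys := sub_eq_zero.1 (congrArg Prod.fst hres)
    have hzy : zs = L.mulVec ys := sub_eq_zero.1 (congrArg (fun r => r.2.1) hres)
    have hxw : xs = ws := sub_eq_zero.1 (congrArg (fun r => r.2.2) hres)
    refine le_antisymm ?_ (le_iInf fun x => ?_)
    · refine (iInf_le _ ⟨xs, hxw ▸ hws⟩).trans_eq ?_
      rw [finiteObj, hzy, ← hxy]
    · have h := hsad x.1 (L.mulVec x.1) x.1 x.1 x.2
      rw [EReal.coe_le_coe_iff]
      simpa [resid, ip3, ip, finiteObj] using h
  rw [hval, ← tendsto_add_atTop_iff_nat 1, and_comm, ← tendsto_add_atTop_iff_nat 1, and_comm]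
  refine ⟨?_, ?_⟩
  · refine hr.congr fun k => ?_
    rw [← tripleToEuclidean_resid, ← norm_tripleToEuclidean_sq, Real.sqrt_sq (norm_nonneg _)]
  · refine ((continuous_coe_real_ereal.tendsto _).comp hobj).congr fun k => ?_
    rw [iota0_of_nonneg (hW k), add_zero]
    rfl
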